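/- arXiv:2112.05038 — 8 statements merged into one kernel-verified Lean document; each statement's English description precedes it below -/
import Mathlib

section
/- Minty's theorem: Let H be a real Hilbert space and c > 0. Let A ⊆ H × H be a c-maximal monotone binary relation. Then the inverse relation A⁻¹ = {(y, x) : (x, y) ∈ A} is the graph of a function defined on all of H that is Lipschitz with constant at most 1/c; that is, there exists f : H → H such that for all x, y ∈ H one has (x, y) ∈ A if and only if f(y) = x, and ‖f(y₁) − f(y₂)‖ ≤ (1/c)·‖y₁ − y₂‖ for all y₁, y₂ ∈ H. -/
open scoped RealInnerProductSpace

/-- A binary relation `A ⊆ H × H` is monotone. -/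
def IsMonotoneRel {H : Type*} [NormedAddCommGroup H] [InnerProductSpace ℝ H]
    (A : Set (H × H)) : Prop :=
  ∀ p ∈ A, ∀ q ∈ A, (0 : ℝ) ≤ ⟪p.1 - q.1, p.2 - q.2⟫

/-- A binary relation is maximal monotone. -/
def IsMaxMonotoneRel {H : Type*} [NormedAddCommGroup H] [InnerProductSpace ℝ H]
    (A : Set (H × H)) : Prop :=
  IsMonotoneRel A ∧ ∀ B : Set (H × H), IsMonotoneRel B → A ⊆ B → B = A

/-- The relation `A - c := {(x, y - c•x) : (x,y) ∈ A}`. -/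
def shiftRel {H : Type*} [NormedAddCommGroup H] [InnerProductSpace ℝ H]
    (A : Set (H × H)) (c : ℝ) : Set (H × H) :=
  (fun q : H × H => (q.1, q.2 - c • q.1)) '' A

/-- `A` is `c`-maximal monotone if `A - c` is maximal monotone. -/
def IsCMaxMonotoneRel {H : Type*} [NormedAddCommGroup H] [InnerProductSpace ℝ H]
    (A : Set (H × H)) (c : ℝ) : Prop :=
  IsMaxMonotoneRel (shiftRel A c)

theorem aux_min {V : Type*} [NormedAddCommGroup V] [InnerProductSpace ℝ V] [CompleteSpace V]
    (E : Set (V × ℝ)) (hcl : IsClosed E) (hcv : Convex ℝ E) (hne : E.Nonempty)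
    (hb : ∀ p ∈ E, 0 ≤ p.2 + ‖p.1‖ ^ 2 / 2) :
    ∃ p ∈ E, ∀ q ∈ E, 0 ≤ q.2 - p.2 + ⟪p.1, q.1 - p.1⟫ := by
  set g : V × ℝ → ℝ := fun p => p.2 + ‖p.1‖ ^ 2 / 2 with hg
  have hbdd : BddBelow (g '' E) := ⟨0, by rintro _ ⟨p, hp, rfl⟩; exact hb p hp⟩
  set m := sInf (g '' E) with hm
  have hle : ∀ p ∈ E, m ≤ g p := fun p hp => csInf_le hbdd ⟨p, hp, rfl⟩
  have hex : ∀ n : ℕ, ∃ p ∈ E, g p < m + 1 / ((n : ℝ) + 1) := by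
    intro n
    have : m < m + 1 / ((n : ℝ) + 1) := by
      have : 0 < 1 / ((n : ℝ) + 1) := by positivity
      linarith
    obtain ⟨_, ⟨p, hp, rfl⟩, h⟩ := exists_lt_of_csInf_lt (hne.image g) this
    exact ⟨p, hp, h⟩
  choose p hpE hpm using hex
  have hlim0 : Filter.Tendsto (fun n : ℕ => 1 / ((n : ℝ) + 1)) Filter.atTop (nhds 0) :=
    tendsto_one_div_add_atTop_nhds_zero_nat
  have hmid : ∀ a ∈ E, ∀ b ∈ E, ‖a.1 - b.1‖ ^ 2 ≤ 4 * ((g a - m) + (g b - m)) := by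
    intro a ha b hb'
    have h1 : (1 / 2 : ℝ) • a + (1 / 2 : ℝ) • b ∈ E :=
      hcv ha hb' (by norm_num) (by norm_num) (by norm_num)
    have h2 := hle _ h1
    have h3 : ‖(1 / 2 : ℝ) • a.1 + (1 / 2 : ℝ) • b.1‖ ^ 2
        = (‖a.1‖ ^ 2 + 2 * ⟪a.1, b.1⟫ + ‖b.1‖ ^ 2) / 4 := by
      rw [← smul_add, norm_smul, mul_pow, norm_add_sq_real]
      norm_num
      ring
    have h4 := norm_sub_sq_real a.1 b.1
    simp only [hg, Prod.fst_add, Prod.snd_add, Prod.smul_fst, Prod.smul_snd, smul_eq_mul] at h2 ⊢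
    rw [h3] at h2
    linarith
  have hC : CauchySeq (fun n => (p n).1) := by
    refine cauchySeq_of_le_tendsto_0 (fun N : ℕ => Real.sqrt (8 * (1 / ((N : ℝ) + 1)))) ?_ ?_
    · intro n k N hn hk
      rw [dist_eq_norm]
      apply Real.le_sqrt_of_sq_le
      have h1 := hmid _ (hpE n) _ (hpE k)
      have h2 := hpm n
      have h3 := hpm k
      have h4 : 1 / ((n : ℝ) + 1) ≤ 1 / ((N : ℝ) + 1) := Nat.one_div_le_one_div hn
      have h5 : 1 / ((k : ℝ) + 1) ≤ 1 / ((N : ℝ) + 1) := Nat.one_div_le_one_div hk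
      linarith
    · have := (hlim0.const_mul 8).sqrt
      simpa using this
  obtain ⟨z, hz⟩ := cauchySeq_tendsto_of_complete hC
  have hgm : Filter.Tendsto (fun n => g (p n)) Filter.atTop (nhds m) := by
    refine tendsto_of_tendsto_of_tendsto_of_le_of_le tendsto_const_nhds
      (by simpa using hlim0.const_add m) (fun n => hle _ (hpE n)) (fun n => (hpm n).le)
  have ht : Filter.Tendsto (fun n => (p n).2) Filter.atTop (nhds (m - ‖z‖ ^ 2 / 2)) := by
    have := hgm.sub ((hz.norm.pow 2).div_const 2)
    simpa [hg] using this
  have hmem : (z, m - ‖z‖ ^ 2 / 2) ∈ E :=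
    hcl.mem_of_tendsto (hz.prodMk_nhds ht) (Filter.Eventually.of_forall hpE)
  refine ⟨_, hmem, ?_⟩
  intro q hq
  set t := m - ‖z‖ ^ 2 / 2 with htdef
  have key : ∀ s : ℝ, 0 < s → s ≤ 1 →
      0 ≤ q.2 - t + ⟪z, q.1 - z⟫ + s * (‖q.1 - z‖ ^ 2 / 2) := by
    intro s hs hs1
    have h1 := hle _ (hcv.add_smul_sub_mem hmem hq ⟨hs.le, hs1⟩)
    have h2 : ‖z + s • (q.1 - z)‖ ^ 2
        = ‖z‖ ^ 2 + 2 * (s * ⟪z, q.1 - z⟫) + s ^ 2 * ‖q.1 - z‖ ^ 2 := by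
      rw [norm_add_sq_real, inner_smul_right, norm_smul, mul_pow]
      simp
    simp only [hg, Prod.fst_add, Prod.snd_add, Prod.smul_fst, Prod.smul_snd, smul_eq_mul,
      Prod.fst_sub, Prod.snd_sub] at h1
    rw [h2] at h1
    have h3 : 0 ≤ s * (q.2 - t + ⟪z, q.1 - z⟫ + s * (‖q.1 - z‖ ^ 2 / 2)) := by
      linarith
    exact nonneg_of_mul_nonneg_right h3 hs
  by_contra hneg
  push Not at hneg
  simp only at hneg
  set a := q.2 - t + ⟪z, q.1 - z⟫ with ha
  set b := ‖q.1 - z‖ ^ 2 / 2 with hbdef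
  have hb0 : 0 ≤ b := by positivity
  have hd : 0 < b - a := by linarith
  have hd2 : 0 < 2 * (b - a) := by linarith
  have := key (-a / (2 * (b - a))) (div_pos (by linarith) hd2)
    (by rw [div_le_one hd2]; linarith)
  have h5 : -a / (2 * (b - a)) * b ≤ -a / 2 := by
    rw [div_mul_eq_mul_div, div_le_div_iff₀ hd2 (by norm_num)]
    nlinarith
  linarith

theorem aux_zero {H : Type*} [NormedAddCommGroup H] [InnerProductSpace ℝ H]
    [CompleteSpace H] (N : Set (H × H)) (hmon : IsMonotoneRel N)
    (hmax : ∀ x y : H, (∀ q ∈ N, (0 : ℝ) ≤ ⟪x - q.1, y - q.2⟫) → (x, y) ∈ N) :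
    ∃ x, (x, -x) ∈ N := by
  let E : Set (WithLp 2 (H × H) × ℝ) :=
    {p | ∀ q ∈ N, ⟪p.1.fst, q.2⟫ + ⟪q.1, p.1.snd⟫ - ⟪q.1, q.2⟫ ≤ p.2}
  have hEN : ∀ q ∈ N, (WithLp.toLp 2 q, ⟪q.1, q.2⟫) ∈ E := by
    intro q hq r hr
    have := hmon q hq r hr
    simp only [inner_sub_left, inner_sub_right] at this
    simp only [WithLp.toLp_fst, WithLp.toLp_snd]
    linarith
  have hNne : N.Nonempty := by
    by_contra h
    rw [Set.not_nonempty_iff_eq_empty] at h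
    have := hmax 0 0 (by simp [h])
    simp [h] at this
  have hcl : IsClosed E := by
    have : E = ⋂ q ∈ N, {p | ⟪p.1.fst, q.2⟫ + ⟪q.1, p.1.snd⟫ - ⟪q.1, q.2⟫ ≤ p.2} := by
      ext p; simp [E]
    rw [this]
    refine isClosed_biInter fun q _ => isClosed_le ?_ continuous_snd
    have h1 : Continuous fun p : WithLp 2 (H × H) × ℝ => p.1.fst :=
      continuous_fst.comp ((WithLp.prod_continuous_ofLp 2 H H).comp continuous_fst)
    have h2 : Continuous fun p : WithLp 2 (H × H) × ℝ => p.1.snd :=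
      continuous_snd.comp ((WithLp.prod_continuous_ofLp 2 H H).comp continuous_fst)
    fun_prop
  have hcv : Convex ℝ E := by
    intro p hp r hr a b ha hb hab q hq
    have h1 := mul_le_mul_of_nonneg_left (hp q hq) ha
    have h2 := mul_le_mul_of_nonneg_left (hr q hq) hb
    simp only [Prod.fst_add, Prod.snd_add, Prod.smul_fst, Prod.smul_snd, smul_eq_mul,
      WithLp.add_fst, WithLp.add_snd, WithLp.smul_fst, WithLp.smul_snd, inner_add_left,
      inner_add_right, real_inner_smul_left, real_inner_smul_right]
    have hb' : b = 1 - a := by linarith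
    subst hb'
    linarith
  have hlow : ∀ p ∈ E, ⟪p.1.fst, p.1.snd⟫ ≤ p.2 := by
    intro p hp
    by_cases h : (p.1.fst, p.1.snd) ∈ N
    · have := hp _ h
      simp only at this
      linarith
    · have h' := mt (hmax _ _) h
      push Not at h'
      obtain ⟨q, hq, hlt⟩ := h'
      have := hp q hq
      simp only [inner_sub_left, inner_sub_right] at hlt
      linarith
  obtain ⟨q0, hq0⟩ := hNne
  obtain ⟨p, hp, hmin⟩ := aux_min E hcl hcv ⟨_, hEN q0 hq0⟩ (by
    intro p hp
    have h1 := hlow p hp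
    rw [WithLp.prod_norm_sq_eq_of_L2]
    have h2 := norm_add_sq_real p.1.fst p.1.snd
    have h3 := sq_nonneg ‖p.1.fst + p.1.snd‖
    linarith)
  have h1 := hlow p hp
  have hk : ∀ q ∈ N, ‖p.1.fst + p.1.snd‖ ^ 2 ≤ ⟪q.1 + p.1.snd, q.2 + p.1.fst⟫ := by
    intro q hq
    have h2 := hmin _ (hEN q hq)
    rw [norm_add_sq_real]
    simp only [WithLp.prod_inner_apply, WithLp.ofLp_sub, Prod.fst_sub, Prod.snd_sub,
      inner_sub_right, real_inner_self_eq_norm_sq] at h2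
    simp only [inner_add_left, inner_add_right]
    have e1 := real_inner_comm p.1.fst p.1.snd
    have e2 := real_inner_comm p.1.fst q.1
    have e3 := real_inner_self_eq_norm_sq p.1.fst
    have e4 := real_inner_self_eq_norm_sq p.1.snd
    simp only [WithLp.fst, WithLp.snd] at *
    linarith
  have hmem : (-p.1.snd, -p.1.fst) ∈ N := by
    apply hmax
    intro q hq
    have h2 := (sq_nonneg _).trans (hk q hq)
    rw [← inner_neg_neg] at h2
    have a1 : -p.1.snd - q.1 = -(q.1 + p.1.snd) := by abel
    have a2 : -p.1.fst - q.2 = -(q.2 + p.1.fst) := by abel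
    rw [a1, a2]
    exact h2
  have h3 := hk _ hmem
  simp only [neg_add_cancel, inner_zero_left] at h3
  have h4 : p.1.fst + p.1.snd = 0 := by
    rw [← norm_eq_zero]
    exact pow_eq_zero_iff (two_ne_zero) |>.1 (le_antisymm h3 (sq_nonneg _))
  refine ⟨-p.1.snd, ?_⟩
  rw [eq_neg_of_add_eq_zero_left h4] at hmem
  exact hmem

/-- Minty's theorem: the inverse of a `c`-maximal monotone relation on a real Hilbert
space is the graph of an everywhere-defined `1/c`-Lipschitz function. -/
theorem minty_theorem {H : Type*} [NormedAddCommGroup H] [InnerProductSpace ℝ H]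
    [CompleteSpace H] (A : Set (H × H)) (c : ℝ) (hc : 0 < c)
    (hA : IsCMaxMonotoneRel A c) :
    ∃ f : H → H, (∀ x y : H, (x, y) ∈ A ↔ f y = x) ∧
      ∀ y₁ y₂ : H, ‖f y₁ - f y₂‖ ≤ (1 / c) * ‖y₁ - y₂‖ := by
  obtain ⟨hmon, hmax⟩ := hA
  set M := shiftRel A c with hM
  have hMA : ∀ x v, (x, v) ∈ M ↔ (x, v + c • x) ∈ A := by
    intro x v
    constructor
    · rintro ⟨⟨a, b⟩, h, he⟩
      simp only [Prod.mk.injEq] at he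
      obtain ⟨rfl, rfl⟩ := he
      simpa using h
    · intro h
      exact ⟨_, h, by simp⟩
  have hchar : ∀ x y : H, (∀ q ∈ M, (0 : ℝ) ≤ ⟪x - q.1, y - q.2⟫) → (x, y) ∈ M := by
    intro x y h
    have := hmax (insert (x, y) M) (by
      rintro p (rfl | hp) q (rfl | hq)
      · simp
      · exact h q hq
      · have := h p hp
        rw [← inner_neg_neg] at this
        simpa using this
      · exact hmon p hp q hq) (Set.subset_insert _ _)
    rw [← this]
    exact Set.mem_insert _ _
  have hex : ∀ y, ∃ x, (x, y) ∈ A := by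
    intro y
    obtain ⟨x, hx⟩ := aux_zero {p : H × H | (p.1, c • p.2 + y) ∈ M} (by
      intro p hp q hq
      have := hmon _ hp _ hq
      simp only [add_sub_add_right_eq_sub, ← smul_sub, real_inner_smul_right] at this
      exact nonneg_of_mul_nonneg_right this hc) (by
      intro x v h
      apply hchar
      intro q hq
      have := h (q.1, c⁻¹ • (q.2 - y)) (by simpa [smul_smul, hc.ne'] using hq)
      have h2 := mul_nonneg hc.le this
      simp only at h2
      rw [← real_inner_smul_right, smul_sub c v, smul_smul, mul_inv_cancel₀ hc.ne', one_smul] at h2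
      have a1 : c • v + y - q.2 = c • v - (q.2 - y) := by abel
      simp only [a1]
      exact h2)
    refine ⟨x, ?_⟩
    have h2 := (hMA _ _).1 hx
    simpa using h2
  have hlip : ∀ x₁ y₁ x₂ y₂, (x₁, y₁) ∈ A → (x₂, y₂) ∈ A →
      ‖x₁ - x₂‖ ≤ (1 / c) * ‖y₁ - y₂‖ := by
    intro x₁ y₁ x₂ y₂ h1 h2
    have h := hmon (x₁, y₁ - c • x₁) ⟨_, h1, rfl⟩ (x₂, y₂ - c • x₂) ⟨_, h2, rfl⟩
    have e : y₁ - c • x₁ - (y₂ - c • x₂) = (y₁ - y₂) - c • (x₁ - x₂) := by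
      rw [smul_sub]; abel
    simp only [e] at h
    rw [inner_sub_right, real_inner_smul_right, real_inner_self_eq_norm_sq] at h
    have h3 := real_inner_le_norm (x₁ - x₂) (y₁ - y₂)
    rw [one_div, inv_mul_eq_div, le_div_iff₀ hc]
    rcases (norm_nonneg (x₁ - x₂)).eq_or_lt with h0 | h0
    · rw [← h0]; simp
    · refine le_of_mul_le_mul_left ?_ h0
      linarith
  choose f hf using hex
  refine ⟨f, fun x y => ⟨fun h => ?_, fun h => h ▸ hf y⟩, fun y₁ y₂ => hlip _ _ _ _ (hf _) (hf _)⟩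
  have := hlip _ _ _ _ (hf y) h
  simp only [sub_self, norm_zero, mul_zero] at this
  exact sub_eq_zero.1 (norm_le_zero_iff.1 this)
end

section
/- Let H be a real Hilbert space and let A, B ⊆ H × H be maximal monotone binary relations such that A is bounded and dom(A) ∩ dom(B) ≠ ∅. Then the sum A + B := {(x, y) : ∃ y_A, y_B ∈ H, (x, y_A) ∈ A, (x, y_B) ∈ B, y = y_A + y_B} is maximal monotone. -/
open scoped RealInnerProductSpace

/-- The domain of a binary relation. -/
def domRel {H : Type*} (A : Set (H × H)) : Set H :=
  {x | ∃ y, (x, y) ∈ A}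

/-- A binary relation is bounded: the post-set of every bounded set is bounded. -/
def IsBoundedRel {H : Type*} [NormedAddCommGroup H] (A : Set (H × H)) : Prop :=
  ∀ M : Set H, Bornology.IsBounded M →
    Bornology.IsBounded {y : H | ∃ x ∈ M, (x, y) ∈ A}

/-- The sum of two binary relations. -/
def sumRel {H : Type*} [AddCommGroup H] (A B : Set (H × H)) : Set (H × H) :=
  {p : H × H | ∃ yA yB : H, (p.1, yA) ∈ A ∧ (p.1, yB) ∈ B ∧ p.2 = yA + yB}

open Filter Topology

lemma aux_conv {H : Type*} [NormedAddCommGroup H] [CompleteSpace H] (x : ℕ → H) (f : ℕ → ℝ)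
    (hf : Monotone f) (M : ℝ) (hM : ∀ n, f n ≤ M)
    (h : ∀ n m, n ≤ m → ‖x n - x m‖ ^ 2 ≤ f m - f n) : ∃ l, Tendsto x atTop (𝓝 l) := by
  have hlim : Tendsto f atTop (𝓝 (⨆ i, f i)) :=
    tendsto_atTop_ciSup hf ⟨M, by rintro _ ⟨n, rfl⟩; exact hM n⟩
  have hc := hlim.cauchySeq
  apply cauchySeq_tendsto_of_complete
  rw [Metric.cauchySeq_iff'] at hc ⊢
  intro ε hε
  obtain ⟨N, hN⟩ := hc (ε ^ 2) (by positivity)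
  refine ⟨N, fun n hn => ?_⟩
  have h1 := hN n hn
  have h2 := h N n hn
  rw [Real.dist_eq] at h1
  rw [dist_comm, dist_eq_norm]
  have h3 := lt_of_le_of_lt h2 (lt_of_le_of_lt (le_abs_self _) h1)
  exact lt_of_pow_lt_pow_left₀ 2 hε.le h3

lemma aux_comb {E : Type*} [NormedAddCommGroup E] [InnerProductSpace ℝ E] (u v : E) (s t : ℝ)
    (h : s + t = 1) : ‖s • u + t • v‖ ^ 2 = s * ‖u‖ ^ 2 + t * ‖v‖ ^ 2 - s * t * ‖u - v‖ ^ 2 := by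
  rw [norm_add_sq_real, norm_sub_sq_real, norm_smul, norm_smul, real_inner_smul_left,
    real_inner_smul_right, mul_pow, mul_pow, Real.norm_eq_abs, Real.norm_eq_abs, sq_abs, sq_abs]
  obtain rfl : t = 1 - s := by linarith
  ring

lemma aux_S {E : Type*} [NormedAddCommGroup E] [InnerProductSpace ℝ E] [CompleteSpace E]
    (C : Set (E × ℝ)) (hC : Convex ℝ C) (hne : C.Nonempty) (hle : ∀ p ∈ C, p.2 ≤ ‖p.1‖ ^ 2) :
    ∃ x : E, ∀ p ∈ C, ‖x‖ ^ 2 - 2 * ⟪x, p.1⟫ + p.2 ≤ 0 := by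
  set g : E × ℝ → ℝ := fun p => p.2 - ‖p.1‖ ^ 2 with hg
  set m := sSup (g '' C) with hm
  have hbd : BddAbove (g '' C) := ⟨0, by
    rintro _ ⟨p, hp, rfl⟩; have := hle p hp; simp only [hg]; linarith⟩
  have hgm : ∀ p ∈ C, g p ≤ m := fun p hp => le_csSup hbd ⟨p, hp, rfl⟩
  have hm0 : m ≤ 0 := by
    apply csSup_le (hne.image g)
    rintro _ ⟨p, hp, rfl⟩; have := hle p hp; simp only [hg]; linarith
  have hcomb : ∀ p ∈ C, ∀ q ∈ C, ∀ t : ℝ, 0 ≤ t → t ≤ 1 →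
      (1 - t) * g p + t * g q + (1 - t) * t * ‖p.1 - q.1‖ ^ 2 ≤ m := by
    intro p hp q hq t h0 h1
    have := hgm _ (hC hp hq (sub_nonneg.2 h1) h0 (by ring))
    simp only [hg, Prod.fst_add, Prod.snd_add, Prod.smul_fst, Prod.smul_snd, smul_eq_mul] at this ⊢
    rw [aux_comb _ _ _ _ (by ring)] at this
    linarith
  have hex : ∀ n : ℕ, ∃ p ∈ C, m - 1 / ((n : ℝ) + 1) < g p := by
    intro n
    obtain ⟨_, ⟨p, hp, rfl⟩, h⟩ := exists_lt_of_lt_csSup (hne.image g)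
      (show m - 1 / ((n : ℝ) + 1) < sSup (g '' C) from by
        have : (0 : ℝ) < 1 / ((n : ℝ) + 1) := by positivity
        linarith)
    exact ⟨p, hp, h⟩
  choose p hp hpg using hex
  have hlim0 : Tendsto (fun n : ℕ => 1 / ((n : ℝ) + 1)) atTop (𝓝 0) :=
    tendsto_one_div_add_atTop_nhds_zero_nat
  have hcau : CauchySeq (fun n => (p n).1) := by
    rw [Metric.cauchySeq_iff']
    intro ε hε
    obtain ⟨N, hN⟩ := (hlim0.eventually (gt_mem_nhds (show 0 < ε ^ 2 / 4 by positivity))).exists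
    refine ⟨N, fun n hn => ?_⟩
    rw [dist_eq_norm]
    have h1 := hcomb _ (hp n) _ (hp N) (1/2) (by norm_num) (by norm_num)
    have h2 := hpg n
    have h3 := hpg N
    have h4 : 1 / ((n : ℝ) + 1) ≤ 1 / ((N : ℝ) + 1) := by
      apply one_div_le_one_div_of_le (by positivity)
      have : (N : ℝ) ≤ n := by exact_mod_cast hn
      linarith
    apply lt_of_pow_lt_pow_left₀ 2 hε.le
    linarith
  obtain ⟨x, hx⟩ := cauchySeq_tendsto_of_complete hcau
  have hgl : Tendsto (fun n => g (p n)) atTop (𝓝 m) := by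
    apply tendsto_of_tendsto_of_tendsto_of_le_of_le (g := fun n : ℕ => m - 1 / ((n : ℝ) + 1))
      (h := fun _ => m) _ tendsto_const_nhds (fun n => (hpg n).le) (fun n => hgm _ (hp n))
    simpa using (tendsto_const_nhds (x := m)).sub hlim0
  refine ⟨x, fun q hq => ?_⟩
  have key : ∀ t : ℝ, 0 < t → t ≤ 1 → g q + (1 - t) * ‖x - q.1‖ ^ 2 ≤ m := by
    intro t h0 h1
    have hl : Tendsto (fun n => (1 - t) * g (p n) + t * g q + (1 - t) * t * ‖(p n).1 - q.1‖ ^ 2)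
        atTop (𝓝 ((1 - t) * m + t * g q + (1 - t) * t * ‖x - q.1‖ ^ 2)) :=
      ((hgl.const_mul _).add tendsto_const_nhds).add
        (((hx.sub tendsto_const_nhds).norm.pow 2).const_mul _)
    have := le_of_tendsto' hl (fun n => hcomb _ (hp n) q hq t h0.le h1)
    have h2 : t * (g q + (1 - t) * ‖x - q.1‖ ^ 2) ≤ t * m := by linarith
    exact le_of_mul_le_mul_left h2 h0
  have hl2 : Tendsto (fun n : ℕ => g q + (1 - 1 / ((n : ℝ) + 1)) * ‖x - q.1‖ ^ 2) atTop
      (𝓝 (g q + (1 - 0) * ‖x - q.1‖ ^ 2)) :=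
    tendsto_const_nhds.add ((tendsto_const_nhds.sub hlim0).mul_const _)
  have := le_of_tendsto' hl2 (fun n => key _ (by positivity) (by
    rw [div_le_one (by positivity)]; have : (0 : ℝ) ≤ n := by positivity
    linarith))
  simp only [hg] at this
  rw [norm_sub_sq_real] at this
  linarith

section
variable {H : Type*} [NormedAddCommGroup H] [InnerProductSpace ℝ H]

lemma aux_mem {A : Set (H × H)} (hA : IsMaxMonotoneRel A) (x y : H)
    (h : ∀ p ∈ A, (0 : ℝ) ≤ ⟪x - p.1, y - p.2⟫) : (x, y) ∈ A := by
  have := hA.2 (insert (x, y) A) ?_ (Set.subset_insert _ _)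
  · rw [← this]; exact Set.mem_insert _ _
  · rintro p (rfl | hp) q (rfl | hq)
    · simp
    · exact h q hq
    · have := h p hp
      rw [← neg_sub p.1, ← neg_sub p.2, inner_neg_neg] at this
      exact this
    · exact hA.1 p hp q hq

lemma aux_closed {A : Set (H × H)} (hA : IsMaxMonotoneRel A) (x y : ℕ → H) (x0 y0 : H)
    (hx : Tendsto x atTop (𝓝 x0)) (hy : Tendsto y atTop (𝓝 y0)) (h : ∀ n, (x n, y n) ∈ A) :
    (x0, y0) ∈ A := by
  apply aux_mem hA
  intro p hp
  have : Tendsto (fun n => ⟪x n - p.1, y n - p.2⟫) atTop (𝓝 ⟪x0 - p.1, y0 - p.2⟫) :=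
    (hx.sub tendsto_const_nhds).inner (hy.sub tendsto_const_nhds)
  exact ge_of_tendsto' this (fun n => hA.1 _ (h n) p hp)

/-- lifted hull -/
def auxHull (A : Set (H × H)) : Set (H × H × ℝ) :=
  convexHull ℝ ((fun p : H × H => (p.1, p.2, ⟪p.1, p.2⟫)) '' A)

lemma aux_half (k : ℝ) (v w : H) :
    Convex ℝ {q : H × H × ℝ | 0 ≤ q.2.2 + k - ⟪q.1, w⟫ - ⟪v, q.2.1⟫} := by
  rintro p hp q hq s t hs ht hst
  simp only [Set.mem_ofPred_eq, Prod.fst_add, Prod.snd_add, Prod.smul_fst, Prod.smul_snd,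
    smul_eq_mul, inner_add_left, inner_add_right, real_inner_smul_left,
    real_inner_smul_right] at hp hq ⊢
  have h1 := mul_nonneg hs hp
  have h2 := mul_nonneg ht hq
  have : k = (s + t) * k := by rw [hst, one_mul]
  rw [this]
  linarith

lemma aux_hull {A : Set (H × H)} (hA : IsMonotoneRel A) (q : H × H × ℝ) (hq : q ∈ auxHull A) :
    ⟪q.1, q.2.1⟫ ≤ q.2.2 := by
  have h1 : ∀ p ∈ A, ∀ r ∈ auxHull A, 0 ≤ r.2.2 + ⟪p.1, p.2⟫ - ⟪r.1, p.2⟫ - ⟪p.1, r.2.1⟫ := by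
    intro p hp r hr
    refine convexHull_min ?_ (aux_half ⟪p.1, p.2⟫ p.1 p.2) hr
    rintro _ ⟨a, ha, rfl⟩
    have := hA a ha p hp
    simp only [inner_sub_left, inner_sub_right] at this
    simp only [Set.mem_ofPred_eq]
    linarith
  have h2 : ∀ r ∈ auxHull A, 0 ≤ r.2.2 + q.2.2 - ⟪r.1, q.2.1⟫ - ⟪q.1, r.2.1⟫ := by
    intro r hr
    refine convexHull_min ?_ (aux_half q.2.2 q.1 q.2.1) hr
    rintro _ ⟨a, ha, rfl⟩
    have := h1 a ha q hq
    simp only [Set.mem_ofPred_eq]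
    linarith
  have := h2 q hq
  linarith

lemma aux_res [CompleteSpace H] {A B : Set (H × H)}
    (hA : IsMaxMonotoneRel A) (hB : IsMaxMonotoneRel B) (hAn : A.Nonempty) (hBn : B.Nonempty)
    (z : H) (ε : ℝ) (hε : 0 < ε) :
    ∃ x y : H, (x - ε • y, y) ∈ A ∧ (x, z - x - y) ∈ B := by
  obtain ⟨s, hs, rfl⟩ : ∃ s : ℝ, 0 < s ∧ s * s = ε :=
    ⟨√ε, Real.sqrt_pos.2 hε, Real.mul_self_sqrt hε.le⟩
  let F : (H × H × ℝ) × (H × H × ℝ) → WithLp 2 (H × H) × ℝ := fun r =>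
    (WithLp.toLp 2 ((1/2 : ℝ) • (z - r.2.2.1 + r.2.1 - r.1.2.1),
      (1/2 : ℝ) • (s • r.1.2.1 + s⁻¹ • (r.2.1 - r.1.1))), ⟪r.2.1, z⟫ - r.2.2.2 - r.1.2.2)
  have hconv : Convex ℝ (F '' (auxHull A ×ˢ auxHull B)) := by
    rintro _ ⟨p, hp, rfl⟩ _ ⟨q, hq, rfl⟩ a b ha hb hab
    refine ⟨a • p + b • q, ((convex_convexHull ℝ _).prod (convex_convexHull ℝ _))
      hp hq ha hb hab, ?_⟩
    obtain rfl : b = 1 - a := by linarith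
    simp only [F, Prod.fst_add, Prod.snd_add, Prod.smul_fst, Prod.smul_snd, smul_eq_mul,
      inner_add_left, real_inner_smul_left, ← WithLp.toLp_smul, ← WithLp.toLp_add, Prod.smul_mk,
      Prod.mk_add_mk, Prod.mk.injEq]
    refine ⟨?_, by ring⟩
    congr 2
    · module
    · module
  have hmem : ∀ p ∈ A, ((p.1, p.2, ⟪p.1, p.2⟫) : H × H × ℝ) ∈ auxHull A := fun p hp =>
    subset_convexHull ℝ _ ⟨p, hp, rfl⟩
  have hmem' : ∀ p ∈ B, ((p.1, p.2, ⟪p.1, p.2⟫) : H × H × ℝ) ∈ auxHull B := fun p hp =>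
    subset_convexHull ℝ _ ⟨p, hp, rfl⟩
  obtain ⟨a0, ha0⟩ := hAn
  obtain ⟨b0, hb0⟩ := hBn
  obtain ⟨X, hX⟩ := aux_S _ hconv ⟨_, ⟨(_, _), ⟨hmem a0 ha0, hmem' b0 hb0⟩, rfl⟩⟩ (by
    rintro _ ⟨⟨⟨a, b, r⟩, ⟨a', b', r'⟩⟩, ⟨h1, h2⟩, rfl⟩
    have h1 := aux_hull hA.1 _ h1
    have h2 := aux_hull hB.1 _ h2
    simp only [F] at h1 h2 ⊢
    rw [WithLp.prod_norm_sq_eq_of_L2]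
    have e1 : ‖(1/2 : ℝ) • (z - b' + a' - b)‖ ^ 2
        = ‖(1/2 : ℝ) • (z - b' - a' - b)‖ ^ 2 + ⟪a', z - b' - b⟫ := by
      simp only [← real_inner_self_eq_norm_sq, inner_add_left, inner_add_right, inner_sub_left,
        inner_sub_right, real_inner_smul_left, real_inner_smul_right]
      simp only [real_inner_comm a' _]
      ring
    have e2 : ‖(1/2 : ℝ) • (s • b + s⁻¹ • (a' - a))‖ ^ 2
        = ‖(1/2 : ℝ) • (s • b - s⁻¹ • (a' - a))‖ ^ 2 + ⟪a' - a, b⟫ := by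
      simp only [← real_inner_self_eq_norm_sq, inner_add_left, inner_add_right, inner_sub_left,
        inner_sub_right, real_inner_smul_left, real_inner_smul_right]
      simp only [real_inner_comm b _]
      field_simp
      ring
    change _ ≤ ‖(1/2 : ℝ) • (z - b' + a' - b)‖ ^ 2 + ‖(1/2 : ℝ) • (s • b + s⁻¹ • (a' - a))‖ ^ 2
    rw [e1, e2]
    have e3 := sq_nonneg ‖(1/2 : ℝ) • (z - b' - a' - b)‖
    have e4 := sq_nonneg ‖(1/2 : ℝ) • (s • b - s⁻¹ • (a' - a))‖
    simp only [inner_sub_right, inner_sub_left]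
    linarith)
  set x := X.fst with hx
  set y := s⁻¹ • X.snd with hy
  have hXs : X.snd = s • y := by rw [hy, smul_smul, mul_inv_cancel₀ hs.ne', one_smul]
  have key : ∀ p ∈ A, ∀ q ∈ B,
      0 ≤ ⟪x - (s * s) • y - p.1, y - p.2⟫ + ⟪x - q.1, z - x - y - q.2⟫ := by
    rintro ⟨a, b⟩ hp ⟨a', b'⟩ hq
    have := hX _ ⟨(_, _), ⟨hmem _ hp, hmem' _ hq⟩, rfl⟩
    rw [WithLp.prod_norm_sq_eq_of_L2, WithLp.prod_inner_apply] at this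
    simp only [F] at this
    change ‖x‖ ^ 2 + ‖X.snd‖ ^ 2 - 2 * (⟪x, _⟫ + ⟪X.snd, _⟫) + _ ≤ 0 at this
    rw [hXs] at this
    simp only [← real_inner_self_eq_norm_sq, inner_add_left, inner_add_right, inner_sub_left,
        inner_sub_right, real_inner_smul_left, real_inner_smul_right] at this ⊢
    rw [real_inner_comm x a']
    rw [real_inner_comm y a']
    rw [real_inner_comm y a]
    field_simp at this
    linarith
  refine ⟨x, y, ?_⟩
  by_cases hcase : ∀ p ∈ A, (0 : ℝ) ≤ ⟪x - (s * s) • y - p.1, y - p.2⟫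
  · have h1 := aux_mem hA _ _ hcase
    refine ⟨h1, aux_mem hB _ _ fun q hq => ?_⟩
    simpa using key _ h1 q hq
  · exfalso
    push Not at hcase
    obtain ⟨p, hp, hneg⟩ := hcase
    have h1 : (x, z - x - y) ∈ B := aux_mem hB _ _ fun q hq => by
      have := key p hp q hq
      linarith
    have := key p hp _ h1
    simp only [sub_self, inner_zero_left, add_zero] at this
    linarith

lemma aux_surj [CompleteSpace H] {A B : Set (H × H)}
    (hA : IsMaxMonotoneRel A) (hB : IsMaxMonotoneRel B)
    (hAbdd : IsBoundedRel A) (hdom : (domRel A ∩ domRel B).Nonempty) (z : H) :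
    ∃ x y : H, (x, y) ∈ A ∧ (x, z - x - y) ∈ B := by
  obtain ⟨x0, ⟨a0, ha0⟩, ⟨b0, hb0⟩⟩ := hdom
  let e : ℕ → ℝ := fun n => 1 / ((n : ℝ) + 1)
  have he0 : ∀ n, 0 < e n := fun n => by positivity
  have he1 : ∀ n, e n ≤ 1 := fun n => by
    simp only [e]
    rw [div_le_one (by positivity)]; have : (0 : ℝ) ≤ n := by positivity
    linarith
  have hanti : ∀ n m, n ≤ m → e m ≤ e n := fun n m h => by
    apply one_div_le_one_div_of_le (by positivity)
    have : (n : ℝ) ≤ m := by exact_mod_cast h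
    linarith
  have hlim0 : Tendsto e atTop (𝓝 0) := tendsto_one_div_add_atTop_nhds_zero_nat
  choose x y hxA hxB using fun n => aux_res hA hB ⟨_, ha0⟩ ⟨_, hb0⟩ z (e n) (he0 n)
  -- bound on `x n - e n • y n`
  have hb1 : ∃ R : ℝ, ∀ n, ‖x n - e n • y n - x0‖ ≤ R := by
    refine ⟨2 * (‖z - x0 - b0 - a0‖ + ‖a0‖), fun n => ?_⟩
    have h1 := hA.1 _ (hxA n) _ ha0
    have h2 := hB.1 _ (hxB n) _ hb0
    have h3 : ‖x n - x0‖ ^ 2 + e n * ‖y n‖ ^ 2 ≤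
        ⟪x n - x0, z - x0 - b0 - a0⟫ + e n * ⟪y n, a0⟫ := by
      simp only [← real_inner_self_eq_norm_sq, inner_sub_left,
        inner_sub_right, real_inner_smul_left] at h1 h2 ⊢
      rw [real_inner_comm x0 (x n)]
      linarith
    have h4 := real_inner_le_norm (x n - x0) (z - x0 - b0 - a0)
    have h5 := real_inner_le_norm (y n) a0
    have h6 := mul_le_mul_of_nonneg_left h5 (he0 n).le
    have h7 : ‖x n - e n • y n - x0‖ ≤ ‖x n - x0‖ + e n * ‖y n‖ := by
      rw [show x n - e n • y n - x0 = (x n - x0) - e n • y n by abel]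
      refine (norm_sub_le _ _).trans ?_
      rw [norm_smul, Real.norm_of_nonneg (he0 n).le]
    set X := ‖x n - x0‖
    set Y := ‖y n‖
    set K := ‖z - x0 - b0 - a0‖
    set L := ‖a0‖
    have hX : 0 ≤ X := norm_nonneg _
    have hY : 0 ≤ Y := norm_nonneg _
    have hK : 0 ≤ K := norm_nonneg _
    have hL : 0 ≤ L := norm_nonneg _
    have h8 : X ^ 2 + (e n * Y) ^ 2 ≤ X * K + (e n * Y) * L := by
      have : (e n * Y) ^ 2 ≤ e n * Y ^ 2 := by
        have := mul_le_mul_of_nonneg_right (he1 n) (mul_nonneg (he0 n).le (sq_nonneg Y))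
        nlinarith
      nlinarith
    set W := e n * Y
    have hW : 0 ≤ W := mul_nonneg (he0 n).le hY
    refine h7.trans ?_
    by_contra hcon
    push Not at hcon
    have h9 : 0 < (X + W) * (X + W - 2 * (K + L)) := mul_pos (by linarith) (by linarith)
    nlinarith [sq_nonneg (X - W), mul_nonneg hX hL, mul_nonneg hW hK]
  obtain ⟨R, hR⟩ := hb1
  obtain ⟨M, hM⟩ := (hAbdd _ (Metric.isBounded_closedBall (x := x0) (r := R))).exists_norm_le
  have hyM : ∀ n, ‖y n‖ ≤ M := fun n =>
    hM _ ⟨_, by rw [Metric.mem_closedBall, dist_eq_norm]; exact hR n, hxA n⟩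
  have hmain : ∀ n m, ‖x n - x m‖ ^ 2 + (e n + e m) / 2 * ‖y n - y m‖ ^ 2
      ≤ (e n - e m) / 2 * (‖y m‖ ^ 2 - ‖y n‖ ^ 2) := by
    intro n m
    have h1 := hA.1 _ (hxA n) _ (hxA m)
    have h2 := hB.1 _ (hxB n) _ (hxB m)
    simp only [← real_inner_self_eq_norm_sq, inner_sub_left,
        inner_sub_right, real_inner_smul_left] at h1 h2 ⊢
    rw [real_inner_comm (x n) (x m), real_inner_comm (y n) (y m)]
    rw [real_inner_comm (x n) (x m)] at h2
    rw [real_inner_comm (y n) (y m)] at h1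
    linarith
  have hmono : Monotone (fun n => ‖y n‖ ^ 2) := by
    intro n m hnm
    rcases hnm.eq_or_lt with rfl | hlt
    · exact le_rfl
    have h := hmain n m
    have h3 : e m < e n := by
      apply one_div_lt_one_div_of_lt (by positivity)
      have : (n : ℝ) < m := by exact_mod_cast hlt
      linarith
    have h4 : 0 ≤ (e n - e m) / 2 * (‖y m‖ ^ 2 - ‖y n‖ ^ 2) := by
      have := he0 n
      have := he0 m
      exact le_trans (by positivity) h
    have := nonneg_of_mul_nonneg_right h4 (by linarith)
    simp only
    linarith
  have hbd : ∀ n, ‖y n‖ ^ 2 ≤ M ^ 2 := fun n => pow_le_pow_left₀ (norm_nonneg _) (hyM n) 2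
  obtain ⟨xl, hxl⟩ := aux_conv x _ hmono _ hbd (by
    intro n m hnm
    have h1 := hmain n m
    have h2 := hmono hnm
    simp only at h2
    have h3 : 0 ≤ (e n + e m) / 2 * ‖y n - y m‖ ^ 2 := by
      have := he0 n
      have := he0 m
      positivity
    have h4 : (e n - e m) / 2 * (‖y m‖ ^ 2 - ‖y n‖ ^ 2) ≤ 1 * (‖y m‖ ^ 2 - ‖y n‖ ^ 2) := by
      apply mul_le_mul_of_nonneg_right _ (by linarith)
      have := he0 m
      have := he1 n
      linarith
    linarith)
  obtain ⟨yl, hyl⟩ := aux_conv y _ hmono _ hbd (by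
    intro n m hnm
    have h1 := hmain n m
    have h2 := hmono hnm
    simp only at h2
    have h3 := sq_nonneg ‖x n - x m‖
    have hm := he0 m
    have hn := he0 n
    have h4 : (e n - e m) / 2 * (‖y m‖ ^ 2 - ‖y n‖ ^ 2)
        ≤ (e n + e m) / 2 * (‖y m‖ ^ 2 - ‖y n‖ ^ 2) := by
      apply mul_le_mul_of_nonneg_right _ (by linarith)
      linarith
    exact le_of_mul_le_mul_left (by linarith) (show 0 < (e n + e m) / 2 by linarith))
  refine ⟨xl, yl, aux_closed hA _ _ _ _ ?_ hyl hxA,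
    aux_closed hB _ _ _ _ hxl ((tendsto_const_nhds.sub hxl).sub hyl) hxB⟩
  simpa using hxl.sub (hlim0.smul hyl)

end

/-- The sum of two maximal monotone relations, the first of which is bounded and whose
domains intersect, is maximal monotone. -/
theorem sum_maxMonotone {H : Type*} [NormedAddCommGroup H] [InnerProductSpace ℝ H]
    [CompleteSpace H] (A B : Set (H × H))
    (hA : IsMaxMonotoneRel A) (hB : IsMaxMonotoneRel B)
    (hAbdd : IsBoundedRel A) (hdom : (domRel A ∩ domRel B).Nonempty) :
    IsMaxMonotoneRel (sumRel A B) := by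
  constructor
  · rintro ⟨p, _⟩ ⟨a, b, ha, hb, rfl⟩ ⟨q, _⟩ ⟨a', b', ha', hb', rfl⟩
    have h1 := hA.1 _ ha _ ha'
    have h2 := hB.1 _ hb _ hb'
    simp only at h1 h2 ⊢
    rw [add_sub_add_comm, inner_add_right]
    exact add_nonneg h1 h2
  · intro C hC hsub
    refine Set.Subset.antisymm ?_ hsub
    rintro ⟨p, q⟩ hpq
    obtain ⟨x, y, hxA, hxB⟩ := aux_surj hA hB hAbdd hdom (p + q)
    have hmem : (x, y + (p + q - x - y)) ∈ sumRel A B := ⟨y, _, hxA, hxB, rfl⟩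
    have h := hC _ hpq _ (hsub hmem)
    simp only at h
    rw [show q - (y + (p + q - x - y)) = -(p - x) by abel, inner_neg_right,
      real_inner_self_eq_norm_sq] at h
    have h0 : ‖p - x‖ = 0 := by
      have := sq_nonneg ‖p - x‖
      exact pow_eq_zero_iff (two_ne_zero) |>.1 (by linarith)
    have hpx : p = x := sub_eq_zero.1 (norm_eq_zero.1 h0)
    subst hpx
    rwa [show y + (p + q - p - y) = q by abel] at hmem
end

section
/- Fix ε > 0. Let A := {(x, y) ∈ ℝ × ℝ : (|x| < 1 and y = 0) or (|x| = 1 and x·y ≥ 0)} and B := A + ε = {(x, y) ∈ ℝ × ℝ : (x, y − ε·x) ∈ A}. Define g : ℝ → ℝ by g(y) = y/ε if |y| < ε and g(y) = y/|y| if |y| ≥ ε. Then for all (x, y) ∈ ℝ × ℝ one has (x, y) ∈ B if and only if x = g(y), and g is Lipschitz with constant 1/ε. -/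
/-- The relation of Example A.4. -/
def exampleRel : Set (ℝ × ℝ) :=
  {p : ℝ × ℝ | (|p.1| < 1 ∧ p.2 = 0) ∨ (|p.1| = 1 ∧ p.1 * p.2 ≥ 0)}

/-- The shifted relation `A + ε = {(x, y) : (x, y − ε·x) ∈ A}`. -/
def shiftedRel (ε : ℝ) : Set (ℝ × ℝ) :=
  {p : ℝ × ℝ | (p.1, p.2 - ε * p.1) ∈ exampleRel}

/-- The resolvent-type function `g` of Example A.6. -/
noncomputable def gFun (ε : ℝ) (y : ℝ) : ℝ :=
  if |y| < ε then y / ε else y / |y|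

theorem gFun_cases (ε : ℝ) (hε : 0 < ε) (y : ℝ) :
    (y ≤ -ε ∧ gFun ε y = -1) ∨ (-ε < y ∧ y < ε ∧ ε * gFun ε y = y) ∨ (ε ≤ y ∧ gFun ε y = 1) := by
  unfold gFun
  split_ifs with h
  · right; left
    rw [abs_lt] at h
    exact ⟨h.1, h.2, by field_simp⟩
  · rcases le_total 0 y with hy | hy
    · right; right
      rw [abs_of_nonneg hy] at h ⊢
      exact ⟨by linarith, div_self (by linarith)⟩
    · left
      rw [abs_of_nonpos hy] at h ⊢
      have : y ≠ 0 := by linarith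
      exact ⟨by linarith, by rw [div_neg, div_self this]⟩

/-- `B = A + ε` is the graph (with axes swapped) of the function `g`, and `g` is
Lipschitz with constant `1/ε`. -/
theorem shiftedRel_graph_and_lipschitz (ε : ℝ) (hε : 0 < ε) :
    (∀ x y : ℝ, (x, y) ∈ shiftedRel ε ↔ x = gFun ε y) ∧
      ∀ y₁ y₂ : ℝ, |gFun ε y₁ - gFun ε y₂| ≤ (1 / ε) * |y₁ - y₂| := by
  constructor
  · intro x y
    have hm : (x, y) ∈ shiftedRel ε ↔
        (|x| < 1 ∧ y - ε * x = 0) ∨ (|x| = 1 ∧ x * (y - ε * x) ≥ 0) := Iff.rfl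
    rw [hm]
    have hg := gFun_cases ε hε y
    generalize gFun ε y = g at hg
    constructor
    · rintro (⟨h1, h2⟩ | ⟨h1, h2⟩)
      · rw [abs_lt] at h1
        rcases hg with ⟨a, b⟩ | ⟨a, b, c⟩ | ⟨a, b⟩
        · nlinarith
        · exact mul_left_cancel₀ hε.ne' (by linarith)
        · nlinarith
      · rcases (abs_eq zero_le_one).1 h1 with rfl | rfl <;>
        rcases hg with ⟨a, b⟩ | ⟨a, b, c⟩ | ⟨a, b⟩ <;> linarith
    · rintro rfl
      rcases hg with ⟨a, rfl⟩ | ⟨a, b, c⟩ | ⟨a, rfl⟩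
      · right; exact ⟨by simp, by linarith⟩
      · left; exact ⟨abs_lt.2 ⟨by nlinarith, by nlinarith⟩, by linarith⟩
      · right; exact ⟨by simp, by linarith⟩
  · intro y z
    have h1 := gFun_cases ε hε y
    have h2 := gFun_cases ε hε z
    generalize gFun ε y = g at h1
    generalize gFun ε z = k at h2
    rw [one_div, ← div_eq_inv_mul, le_div_iff₀ hε]
    have e : |g - k| * ε = |ε * g - ε * k| := by
      rw [← mul_sub, abs_mul, abs_of_pos hε, mul_comm]
    rw [e, abs_le]
    have := le_abs_self (y - z)
    have := neg_abs_le (y - z)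
    have := abs_nonneg (y - z)
    rcases h1 with ⟨a, rfl⟩ | ⟨a, b, c⟩ | ⟨a, rfl⟩ <;>
    rcases h2 with ⟨a', rfl⟩ | ⟨a', b', c'⟩ | ⟨a', rfl⟩ <;>
    constructor <;> linarith
end

section
/- Tresca friction is a monotone relation with bounded inverse (pointwise form of Lemma 5.8): Let V be a real inner product space and τ > 0. Define the Tresca relation A_τ := {(σ, e) ∈ V × V : ‖σ‖ ≤ τ and (e = 0 or τ·e = ‖e‖·σ)}. Then (0, 0) ∈ A_τ; every (σ, e) ∈ A_τ satisfies ‖σ‖ ≤ τ; and A_τ is monotone, i.e. ⟨σ₁ − σ₂, e₁ − e₂⟩ ≥ 0 for all (σ₁, e₁), (σ₂, e₂) ∈ A_τ. -/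
open scoped RealInnerProductSpace

/-- The pointwise Tresca friction relation with threshold `τ`. -/
def trescaRel {V : Type*} [NormedAddCommGroup V] [InnerProductSpace ℝ V] (τ : ℝ) :
    Set (V × V) :=
  {p : V × V | ‖p.1‖ ≤ τ ∧ (p.2 = 0 ∨ τ • p.2 = ‖p.2‖ • p.1)}

theorem trescaRel_aux {V : Type*} [NormedAddCommGroup V] [InnerProductSpace ℝ V] (τ : ℝ)
    (σ e s : V) (h : e = 0 ∨ τ • e = ‖e‖ • σ) (hs : ‖s‖ ≤ τ) :
    ⟪s, e⟫ ≤ ⟪σ, e⟫ := by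
  by_cases he : e = 0
  · simp [he]
  have h2 : τ • e = ‖e‖ • σ := h.resolve_left he
  have hpos : 0 < ‖e‖ := norm_pos_iff.mpr he
  have h3 : ⟪τ • e, e⟫ = ⟪‖e‖ • σ, e⟫ := by rw [h2]
  rw [real_inner_smul_left, real_inner_smul_left, real_inner_self_eq_norm_sq] at h3
  have h4 : ⟪σ, e⟫ = τ * ‖e‖ := by
    apply mul_left_cancel₀ hpos.ne'
    linarith
  rw [h4]
  exact (real_inner_le_norm s e).trans (mul_le_mul_of_nonneg_right hs hpos.le)

/-- Tresca friction contains `(0,0)`, has bounded stress, and is a monotone relation. -/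
theorem trescaRel_monotone_boundedInverse {V : Type*} [NormedAddCommGroup V]
    [InnerProductSpace ℝ V] (τ : ℝ) (hτ : 0 < τ) :
    ((0 : V), (0 : V)) ∈ trescaRel (V := V) τ ∧
    (∀ p ∈ trescaRel (V := V) τ, ‖p.1‖ ≤ τ) ∧
    (∀ p ∈ trescaRel (V := V) τ, ∀ q ∈ trescaRel (V := V) τ,
      (0 : ℝ) ≤ ⟪p.1 - q.1, p.2 - q.2⟫) := by
  refine ⟨⟨by simpa using hτ.le, Or.inl rfl⟩, fun p hp => hp.1, ?_⟩
  intro p hp q hq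
  have h1 := trescaRel_aux τ p.1 p.2 q.1 hp.2 hq.1
  have h2 := trescaRel_aux τ q.1 q.2 p.1 hq.2 hp.1
  rw [inner_sub_left, inner_sub_right, inner_sub_right]
  linarith
end

section
/- The regularized Tresca friction relation is monotone and bounded (pointwise form of Lemma 5.11): Let V be a real inner product space, τ > 0, and c_∞ > 0. Define A := {(σ, e) ∈ V × V : ‖e‖ ≤ c_∞ and ((‖σ‖ ≤ τ and τ·e = ‖e‖·σ) or (‖σ‖ > τ and ‖σ‖·e = c_∞·σ))}. Then (0, 0) ∈ A; every (σ, e) ∈ A satisfies ‖e‖ ≤ c_∞; and A is monotone: ⟨σ₁ − σ₂, e₁ − e₂⟩ ≥ 0 for all (σ₁, e₁), (σ₂, e₂) ∈ A. -/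
open scoped RealInnerProductSpace

/-- The pointwise regularized Tresca friction relation with threshold `τ` and maximal
strain rate `c∞`. -/
def trescaRegRel {V : Type*} [NormedAddCommGroup V] [InnerProductSpace ℝ V]
    (τ cinf : ℝ) : Set (V × V) :=
  {p : V × V | ‖p.2‖ ≤ cinf ∧
    ((‖p.1‖ ≤ τ ∧ τ • p.2 = ‖p.2‖ • p.1) ∨ (‖p.1‖ > τ ∧ ‖p.1‖ • p.2 = cinf • p.1))}

theorem tresca_aux {V : Type*} [NormedAddCommGroup V] [InnerProductSpace ℝ V]
    (τ cinf : ℝ) (hτ : 0 < τ) (hcinf : 0 < cinf) (p : V × V)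
    (hp : p ∈ trescaRegRel (V := V) τ cinf) :
    ⟪p.1, p.2⟫ = ‖p.1‖ * ‖p.2‖ ∧ ‖p.2‖ ≤ cinf ∧
      ((‖p.1‖ ≤ τ ∧ ‖p.2‖ = 0) ∨ ‖p.1‖ = τ ∨ (τ < ‖p.1‖ ∧ ‖p.2‖ = cinf)) := by
  obtain ⟨hb, ⟨h1, h2⟩ | ⟨h1, h2⟩⟩ := hp
  · have hn : τ * ‖p.2‖ = ‖p.2‖ * ‖p.1‖ := by
      have := congrArg norm h2
      simpa [norm_smul, abs_of_pos hτ] using this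
    have hi : τ * ⟪p.1, p.2⟫ = ‖p.2‖ * (‖p.1‖ * ‖p.1‖) := by
      rw [← real_inner_smul_right, h2, real_inner_smul_right, real_inner_self_eq_norm_mul_norm]
    refine ⟨?_, hb, ?_⟩
    · apply mul_left_cancel₀ hτ.ne'
      rw [hi]; linear_combination (-‖p.1‖) * hn
    · by_cases h0 : ‖p.2‖ = 0
      · exact Or.inl ⟨h1, h0⟩
      · right; left
        apply mul_left_cancel₀ h0
        linarith
  · have hs : 0 < ‖p.1‖ := hτ.trans h1
    have hn : ‖p.1‖ * ‖p.2‖ = cinf * ‖p.1‖ := by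
      have := congrArg norm h2
      rwa [norm_smul, norm_smul, norm_norm, Real.norm_of_nonneg hcinf.le] at this
    have hi : ‖p.1‖ * ⟪p.1, p.2⟫ = cinf * (‖p.1‖ * ‖p.1‖) := by
      rw [← real_inner_smul_right, h2, real_inner_smul_right, real_inner_self_eq_norm_mul_norm]
    refine ⟨?_, hb, Or.inr (Or.inr ⟨h1, ?_⟩)⟩
    · apply mul_left_cancel₀ hs.ne'
      rw [hi]; linear_combination (-‖p.1‖) * hn
    · apply mul_left_cancel₀ hs.ne'
      linarith

/-- The regularized Tresca friction relation contains `(0,0)`, has strain rate bounded by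
`c∞`, and is monotone. -/
theorem trescaRegRel_monotone_bounded {V : Type*} [NormedAddCommGroup V]
    [InnerProductSpace ℝ V] (τ cinf : ℝ) (hτ : 0 < τ) (hcinf : 0 < cinf) :
    ((0 : V), (0 : V)) ∈ trescaRegRel (V := V) τ cinf ∧
    (∀ p ∈ trescaRegRel (V := V) τ cinf, ‖p.2‖ ≤ cinf) ∧
    (∀ p ∈ trescaRegRel (V := V) τ cinf, ∀ q ∈ trescaRegRel (V := V) τ cinf,
      (0 : ℝ) ≤ ⟪p.1 - q.1, p.2 - q.2⟫) := by
  refine ⟨?_, fun p hp => hp.1, ?_⟩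
  · exact ⟨by simpa using hcinf.le, Or.inl ⟨by simpa using hτ.le, by simp⟩⟩
  intro p hp q hq
  obtain ⟨ip, bp, cp⟩ := tresca_aux τ cinf hτ hcinf p hp
  obtain ⟨iq, bq, cq⟩ := tresca_aux τ cinf hτ hcinf q hq
  have h1 := real_inner_le_norm p.1 q.2
  have h2 := real_inner_le_norm q.1 p.2
  have n1 := norm_nonneg p.2
  have n2 := norm_nonneg q.2
  have key : 0 ≤ (‖p.1‖ - ‖q.1‖) * (‖p.2‖ - ‖q.2‖) := by
    rcases cp with ⟨a, b⟩ | a | ⟨a, b⟩ <;> rcases cq with ⟨c, d⟩ | c | ⟨c, d⟩ <;>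
    first
      | exact mul_nonneg (by linarith) (by linarith)
      | exact mul_nonneg_of_nonpos_of_nonpos (by linarith) (by linarith)
      | (rw [b, d]; simp)
      | (rw [a, c]; simp)
  rw [inner_sub_left, inner_sub_right, inner_sub_right, ip, iq]
  linarith
end

section
/- The regularized normal contact relation is monotone (pointwise form of Lemma 5.12): Let C₃ ≥ 0, C₄ ≥ 1, and c_∞ > 0 be real constants. Define A := {(σ, e) ∈ ℝ × ℝ : e ≤ c_∞ and σ ≥ −C₃·(max(−e, 0))^{C₄} and (σ + C₃·(max(−e, 0))^{C₄})·(e − c_∞) = 0}. Then (0, 0) ∈ A and A is monotone: (σ₁ − σ₂)·(e₁ − e₂) ≥ 0 for all (σ₁, e₁), (σ₂, e₂) ∈ A. -/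
/-- The pointwise regularized normal contact relation with parameters `C₃, C₄` and
opening-rate cap `c∞`. -/
noncomputable def contactRegRel (C₃ C₄ cinf : ℝ) : Set (ℝ × ℝ) :=
  {p : ℝ × ℝ | p.2 ≤ cinf ∧ p.1 ≥ -C₃ * (max (-p.2) 0) ^ C₄ ∧
    (p.1 + C₃ * (max (-p.2) 0) ^ C₄) * (p.2 - cinf) = 0}

theorem contactRegRel_aux (C₃ C₄ cinf : ℝ) (hC₃ : 0 ≤ C₃) (hC₄ : 1 ≤ C₄)
    (p q : ℝ × ℝ) (hp : p ∈ contactRegRel C₃ C₄ cinf) (hq : q ∈ contactRegRel C₃ C₄ cinf)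
    (h : p.2 < q.2) : p.1 ≤ q.1 := by
  obtain ⟨_, _, hp3⟩ := hp
  obtain ⟨hq1, hq2, _⟩ := hq
  have hne : p.2 - cinf ≠ 0 := by
    intro h0
    linarith
  have h1 := (mul_eq_zero.mp hp3).resolve_right hne
  have h2 : (max (-q.2) 0) ^ C₄ ≤ (max (-p.2) 0) ^ C₄ :=
    Real.rpow_le_rpow (le_max_right _ _) (max_le_max (by linarith) le_rfl) (by linarith)
  have h3 := mul_le_mul_of_nonneg_left h2 hC₃
  linarith

/-- The regularized normal contact relation contains `(0,0)` and is monotone. -/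
theorem contactRegRel_monotone (C₃ C₄ cinf : ℝ) (hC₃ : 0 ≤ C₃) (hC₄ : 1 ≤ C₄)
    (hcinf : 0 < cinf) :
    ((0 : ℝ), (0 : ℝ)) ∈ contactRegRel C₃ C₄ cinf ∧
    (∀ p ∈ contactRegRel C₃ C₄ cinf, ∀ q ∈ contactRegRel C₃ C₄ cinf,
      (0 : ℝ) ≤ (p.1 - q.1) * (p.2 - q.2)) := by
  refine ⟨?_, ?_⟩
  · have h0 : (0 : ℝ) ^ C₄ = 0 := Real.zero_rpow (by linarith)
    refine ⟨hcinf.le, ?_, ?_⟩ <;> simp [h0]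
  · intro p hp q hq
    rcases lt_trichotomy p.2 q.2 with h | h | h
    · have := contactRegRel_aux C₃ C₄ cinf hC₃ hC₄ p q hp hq h
      exact mul_nonneg_of_nonpos_of_nonpos (by linarith) (by linarith)
    · simp [h]
    · have := contactRegRel_aux C₃ C₄ cinf hC₃ hC₄ q p hq hp h
      exact mul_nonneg (by linarith) (by linarith)
end

section
/- Coercivity of the isotropic Hooke law with constant (2μ + nλ)⁻¹ (from Example 5.1): Let n be a finite index type with cardinality N, let μ > 0 and λ ≥ 0 be real, and let e be a real N × N matrix. Set s := 2μ·e + λ·(trace e)·I, where I is the identity matrix. Then, with respect to the Frobenius inner product ⟨A, B⟩ := trace(Aᵀ·B), one has ⟨s, e⟩ ≥ (2μ + N·λ)⁻¹·⟨s, s⟩; that is, trace(sᵀ·e) ≥ (2μ + N·λ)⁻¹·trace(sᵀ·s). -/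
open Matrix

/-- Coercivity of the isotropic Hooke law with constant `(2μ + Nλ)⁻¹`: for
`s = 2μ·e + λ·(tr e)·I` one has `⟨s, e⟩ ≥ (2μ + Nλ)⁻¹·⟨s, s⟩` in the Frobenius
inner product. -/
theorem hooke_coercive {n : Type*} [Fintype n] [DecidableEq n]
    (μ lam : ℝ) (hμ : 0 < μ) (hlam : 0 ≤ lam) (e : Matrix n n ℝ) :
    (((2 * μ) • e + (lam * e.trace) • (1 : Matrix n n ℝ))ᵀ * e).trace ≥
      (2 * μ + (Fintype.card n : ℝ) * lam)⁻¹ *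
        (((2 * μ) • e + (lam * e.trace) • (1 : Matrix n n ℝ))ᵀ *
          ((2 * μ) • e + (lam * e.trace) • (1 : Matrix n n ℝ))).trace := by
  have hF : e.trace ^ 2 ≤ (Fintype.card n : ℝ) * (eᵀ * e).trace := by
    have h1 : e.trace ^ 2 ≤ (Fintype.card n : ℝ) * ∑ i, e i i ^ 2 := by
      have := sq_sum_le_card_mul_sum_sq (s := (Finset.univ : Finset n)) (f := fun i => e i i)
      simpa [Matrix.trace] using this
    refine h1.trans (mul_le_mul_of_nonneg_left ?_ (Nat.cast_nonneg _))
    simp only [Matrix.trace, Matrix.diag_apply, Matrix.mul_apply, Matrix.transpose_apply]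
    refine Finset.sum_le_sum fun i _ => ?_
    have := Finset.single_le_sum (f := fun j => e j i * e j i)
      (fun j _ => mul_self_nonneg (e j i)) (Finset.mem_univ i)
    simpa [sq] using this
  have hpos : 0 < 2 * μ + (Fintype.card n : ℝ) * lam := by positivity
  rw [ge_iff_le, inv_mul_le_iff₀ hpos]
  simp only [Matrix.transpose_add, Matrix.transpose_smul, Matrix.transpose_one, Matrix.add_mul,
    Matrix.mul_add, Matrix.smul_mul, Matrix.mul_smul, Matrix.one_mul, Matrix.mul_one,
    Matrix.trace_add, Matrix.trace_smul, Matrix.trace_one, Matrix.trace_transpose, smul_eq_mul]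
  have h := mul_nonneg (mul_nonneg hμ.le hlam) (sub_nonneg.2 hF)
  nlinarith [h]
end

section
/- Monotonicity of the truncated normalization map (case 2 of the proof of Lemma 5.11): Let V be a real inner product space and τ > 0. Define h : V → V by h(σ) := σ/‖σ‖ if ‖σ‖ > τ and h(σ) := 0 otherwise. Then for all σ₁, σ₂ ∈ V, ⟨h(σ₁) − h(σ₂), σ₁ − σ₂⟩ ≥ 0. -/
open scoped RealInnerProductSpace

/-- The truncated normalization map `σ ↦ 1_{‖σ‖>τ}·σ/‖σ‖`. -/
noncomputable def truncNormalize {V : Type*} [NormedAddCommGroup V]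
    [InnerProductSpace ℝ V] (τ : ℝ) (σ : V) : V :=
  if ‖σ‖ > τ then ‖σ‖⁻¹ • σ else 0

/-- Monotonicity of the truncated normalization map. -/
theorem truncNormalize_monotone {V : Type*} [NormedAddCommGroup V]
    [InnerProductSpace ℝ V] (τ : ℝ) (hτ : 0 < τ) (σ₁ σ₂ : V) :
    (0 : ℝ) ≤ ⟪truncNormalize τ σ₁ - truncNormalize τ σ₂, σ₁ - σ₂⟫ := by
  have key : ∀ a b : ℝ, 0 ≤ a → 0 ≤ b → 0 ≤ (a * ‖σ₁‖ - b * ‖σ₂‖) * (‖σ₁‖ - ‖σ₂‖) →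
      (0 : ℝ) ≤ ⟪a • σ₁ - b • σ₂, σ₁ - σ₂⟫ := by
    intro a b ha hb h
    have hs := real_inner_le_norm σ₁ σ₂
    have h2 := mul_le_mul_of_nonneg_left hs (add_nonneg ha hb)
    simp only [inner_sub_left, inner_sub_right, real_inner_smul_left,
      real_inner_self_eq_norm_sq, real_inner_comm σ₁ σ₂]
    rw [real_inner_comm] at h2
    nlinarith
  have hn : ∀ σ : V, truncNormalize τ σ = (if ‖σ‖ > τ then ‖σ‖⁻¹ else 0) • σ := by
    intro σ
    unfold truncNormalize
    split_ifs <;> simp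
  rw [hn, hn]
  apply key
  · split_ifs <;> positivity
  · split_ifs <;> positivity
  · split_ifs with h1 h2 h2
    · rw [inv_mul_cancel₀ (by linarith), inv_mul_cancel₀ (by linarith)]; simp
    · rw [inv_mul_cancel₀ (by linarith)]; linarith
    · rw [inv_mul_cancel₀ (by linarith)]; linarith
    · simp
end
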